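/- arXiv:1305.1914 — 2 statements merged into one kernel-verified Lean document; each statement's English description precedes it below -/
import Mathlib

section
/- (Hilton–Rees) Let 𝒜 be an abelian category with enough projectives and let A and B be objects of 𝒜. The map Hom(B,A) → Nat(Ext¹(A,-), Ext¹(B,-)), sending f : B → A to the natural transformation Ext¹(f,-), is surjective and its kernel is exactly the subgroup of morphisms B → A that factor through a projective object; hence it induces an isomorphism of abelian groups between Hom(B,A) modulo morphisms factoring through projectives and the group of natural transformations from Ext¹(A,-) to Ext¹(B,-). -/
open CategoryTheory CategoryTheory.Limits CategoryTheory.Abelian Opposite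

universe w v u

/-- (Hilton–Rees) Let `𝒜` be an abelian category with enough projectives and `A`, `B`
objects of `𝒜`.  The assignment `f ↦ Ext¹(f,-)` is an additive map
`Hom(B,A) → Nat(Ext¹(A,-), Ext¹(B,-))` which is surjective and whose kernel consists
exactly of the morphisms `B ⟶ A` factoring through a projective object; hence it induces
an isomorphism of abelian groups between `Hom(B,A)` modulo morphisms factoring through
projectives and the group of natural transformations `Ext¹(A,-) ⟶ Ext¹(B,-)`. -/
theorem hilton_rees {𝒜 : Type u} [Category.{v} 𝒜] [Abelian 𝒜] [EnoughProjectives 𝒜]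
    [HasExt.{w} 𝒜] (A B : 𝒜) :
    ∃ e : (B ⟶ A) →+ ((extFunctor.{w} 1).obj (op A) ⟶ (extFunctor.{w} 1).obj (op B)),
      (∀ f : B ⟶ A, e f = (extFunctor.{w} 1).map f.op) ∧
      Function.Surjective e ∧
      (∀ f : B ⟶ A, e f = 0 ↔
        ∃ (P : 𝒜) (_ : Projective P) (g : B ⟶ P) (h : P ⟶ A), g ≫ h = f) := by
  let S := ShortComplex.mk _ _ (kernel.condition (Projective.π A))
  have hS : S.ShortExact :=
    { exact := ShortComplex.exact_of_f_is_kernel _ (kernelIsKernel S.g) }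
  have happ : ∀ (f : B ⟶ A) (Y : 𝒜) (x : Ext.{w} A Y 1),
      (((extFunctor.{w} 1).map f.op).app Y).hom x = (Ext.mk₀ f).comp x (zero_add 1) :=
    fun _ _ _ => rfl
  have hadd : ∀ f g : B ⟶ A, (extFunctor.{w} 1).map (f + g).op =
      (extFunctor.{w} 1).map f.op + (extFunctor.{w} 1).map g.op := by
    intro f g
    rw [op_add, Functor.map_add]
  refine ⟨AddMonoidHom.mk' (fun f => (extFunctor.{w} 1).map f.op) hadd, fun _ => rfl, ?_, ?_⟩
  · intro τ
    let T : ∀ Y : 𝒜, Ext.{w} A Y 1 →+ Ext.{w} B Y 1 := fun Y => (τ.app Y).hom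
    have hT : ∀ (Y : 𝒜) (x : Ext.{w} A Y 1), (τ.app Y).hom x = T Y x := fun _ _ => rfl
    have hnat : ∀ {Y Z : 𝒜} (g : Y ⟶ Z) (x : Ext.{w} A Y 1),
        T Z (x.comp (Ext.mk₀ g) (add_zero 1)) = (T Y x).comp (Ext.mk₀ g) (add_zero 1) := by
      intro Y Z g x
      have h1 := congrArg AddCommGrpCat.Hom.hom (τ.naturality g)
      rw [AddCommGrpCat.hom_comp, AddCommGrpCat.hom_comp] at h1
      have h2 := DFunLike.congr_fun h1 x
      exact h2
    clear_value T
    let η : Ext.{w} A S.X₁ 1 := hS.extClass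
    have hη : η.comp (Ext.mk₀ S.f) (add_zero 1) = 0 := hS.extClass_comp
    obtain ⟨x₃, hx₃⟩ := Ext.covariant_sequence_exact₁ B hS (T S.X₁ η)
      (by rw [← hnat, hη, map_zero]) (zero_add 1)
    obtain ⟨f, rfl⟩ := Ext.mk₀_bijective _ _ |>.2 x₃
    refine ⟨f, ?_⟩
    ext Y x
    obtain ⟨k, rfl⟩ := Ext.contravariant_sequence_exact₃ hS Y x
      (Ext.eq_zero_of_projective (P := Projective.over A) _) (add_zero 1)
    obtain ⟨k, rfl⟩ := Ext.mk₀_bijective _ _ |>.2 k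
    refine (happ f Y _).trans ?_
    refine Eq.trans ?_ (hT Y _).symm
    refine Eq.trans ?_ (hnat k η).symm
    rw [← hx₃, Ext.comp_assoc_of_third_deg_zero]
  · intro f
    constructor
    · intro h
      have h0 : (Ext.mk₀ f).comp hS.extClass (zero_add 1) = 0 := by
        rw [← happ]
        change (extFunctor.{w} 1).map f.op = 0 at h
        rw [h]
        rfl
      obtain ⟨x₂, hx₂⟩ := Ext.covariant_sequence_exact₃ B hS _ (zero_add 1) h0
      obtain ⟨g, rfl⟩ := Ext.mk₀_bijective _ _ |>.2 x₂
      refine ⟨Projective.over A, inferInstance, g, Projective.π A, ?_⟩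
      rw [Ext.mk₀_comp_mk₀] at hx₂
      exact (Ext.mk₀_bijective _ _).1 hx₂
    · rintro ⟨P, hP, g, h, rfl⟩
      ext Y x
      have key : ∀ y : Ext.{w} A Y 1, (Ext.mk₀ (g ≫ h)).comp y (zero_add 1) = 0 := by
        intro y
        rw [← Ext.mk₀_comp_mk₀_assoc,
          Ext.eq_zero_of_projective ((Ext.mk₀ h).comp y (zero_add 1)), Ext.comp_zero]
      exact (happ _ Y x).trans (key x)
end

section
/- (Hilton–Rees, contravariant version) Let 𝒜 be an abelian category with enough injectives and let A and B be objects of 𝒜. The map Hom(A,B) → Nat(Ext¹(-,A), Ext¹(-,B)), sending f : A → B to the natural transformation Ext¹(-,f), is surjective and its kernel is exactly the subgroup of morphisms A → B that factor through an injective object; hence it induces an isomorphism of abelian groups between Hom(A,B) modulo morphisms factoring through injectives and the group of natural transformations from Ext¹(-,A) to Ext¹(-,B). -/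
open CategoryTheory CategoryTheory.Limits CategoryTheory.Abelian Opposite

universe w v u

/-- Naturality of a transformation `Ext¹(-,A) ⟶ Ext¹(-,B)` in terms of elements. -/
theorem hilton_rees_nat {𝒜 : Type u} [Category.{v} 𝒜] [Abelian 𝒜] [HasExt.{w} 𝒜] {A B : 𝒜}
    (η : (extFunctor.{w} 1).flip.obj A ⟶ (extFunctor.{w} 1).flip.obj B)
    {X Y : 𝒜} (g : X ⟶ Y) (x : Ext.{w} Y A 1) :
    (show Ext.{w} X B 1 from (η.app (op X)).hom ((Ext.mk₀ g).comp x (zero_add 1))) =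
      (Ext.mk₀ g).comp (show Ext.{w} Y B 1 from (η.app (op Y)).hom x) (zero_add 1) := by
  have h := congrArg (fun φ => φ.hom x) (η.naturality g.op)
  exact h

/-- Two transformations agreeing on elements are equal. -/
theorem hilton_rees_ext {𝒜 : Type u} [Category.{v} 𝒜] [Abelian 𝒜] [HasExt.{w} 𝒜] {A B : 𝒜}
    (η θ : (extFunctor.{w} 1).flip.obj A ⟶ (extFunctor.{w} 1).flip.obj B)
    (h : ∀ (X : 𝒜) (x : Ext.{w} X A 1), (show Ext.{w} X B 1 from (η.app (op X)).hom x) =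
      (show Ext.{w} X B 1 from (θ.app (op X)).hom x)) : η = θ := by
  apply NatTrans.ext
  funext X
  apply AddCommGrpCat.hom_ext
  apply AddMonoidHom.ext
  intro x
  exact h X.unop x

/-- (Hilton–Rees, contravariant version) Let `𝒜` be an abelian category with enough
injectives and `A`, `B` objects of `𝒜`.  The assignment `f ↦ Ext¹(-,f)` is an additive
map `Hom(A,B) → Nat(Ext¹(-,A), Ext¹(-,B))` which is surjective and whose kernel consists
exactly of the morphisms `A ⟶ B` factoring through an injective object; hence it induces
an isomorphism of abelian groups between `Hom(A,B)` modulo morphisms factoring through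
injectives and the group of natural transformations `Ext¹(-,A) ⟶ Ext¹(-,B)`. -/
theorem hilton_rees_contravariant {𝒜 : Type u} [Category.{v} 𝒜] [Abelian 𝒜]
    [EnoughInjectives 𝒜] [HasExt.{w} 𝒜] (A B : 𝒜) :
    ∃ e : (A ⟶ B) →+ ((extFunctor.{w} 1).flip.obj A ⟶ (extFunctor.{w} 1).flip.obj B),
      (∀ f : A ⟶ B, e f = (extFunctor.{w} 1).flip.map f) ∧
      Function.Surjective e ∧
      (∀ f : A ⟶ B, e f = 0 ↔
        ∃ (I : 𝒜) (_ : Injective I) (g : A ⟶ I) (h : I ⟶ B), g ≫ h = f) := by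
  have happ : ∀ (f : A ⟶ B) (X : 𝒜) (x : Ext.{w} X A 1),
      (show Ext.{w} X B 1 from (((extFunctor.{w} 1).flip.map f).app (op X)).hom x) =
        x.comp (Ext.mk₀ f) (add_zero 1) := fun _ _ _ => rfl
  let ip : InjectivePresentation A := (EnoughInjectives.presentation A).some
  have hS := ip.shortExact_shortComplex
  have : Injective ip.J := ip.injective
  refine ⟨AddMonoidHom.mk' (fun f => (extFunctor.{w} 1).flip.map f) ?_, fun _ => rfl, ?_, ?_⟩
  · intro f g
    apply hilton_rees_ext
    intro X x
    rw [happ, Ext.mk₀_add, Ext.comp_add]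
    rfl
  · intro η
    let y : Ext.{w} ip.shortComplex.X₃ B 1 := (η.app (op ip.shortComplex.X₃)).hom hS.extClass
    have hy : (Ext.mk₀ ip.shortComplex.g).comp y (zero_add 1) = 0 := by
      have h := hilton_rees_nat η ip.shortComplex.g hS.extClass
      rw [hS.comp_extClass] at h
      exact h.symm.trans (map_zero (η.app (op ip.shortComplex.X₂)).hom)
    obtain ⟨x₁, hx₁⟩ := Ext.contravariant_sequence_exact₃ hS B y hy (add_zero 1)
    obtain ⟨f, rfl⟩ := Ext.addEquiv₀.symm.surjective x₁
    refine ⟨f, ?_⟩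
    apply hilton_rees_ext
    intro X x
    refine (happ f X x).trans ?_
    obtain ⟨x₃, rfl⟩ := Ext.covariant_sequence_exact₁ X hS x
      (Ext.eq_zero_of_injective (I := ip.J) _) (zero_add 1)
    obtain ⟨g, rfl⟩ := Ext.addEquiv₀.symm.surjective x₃
    refine Eq.trans ?_ (hilton_rees_nat η g hS.extClass).symm
    refine Eq.trans ?_ (congrArg (fun z => (Ext.mk₀ g).comp z (zero_add 1)) hx₁)
    exact Ext.comp_assoc_of_third_deg_zero _ _ _ _
  · intro f
    constructor
    · intro hf
      have h : hS.extClass.comp (Ext.mk₀ f) (add_zero 1) = 0 := by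
        refine (happ f _ hS.extClass).symm.trans ?_
        have hf' : (extFunctor.{w} 1).flip.map f = 0 := hf
        rw [hf']
        rfl
      obtain ⟨x₂, hx₂⟩ := Ext.contravariant_sequence_exact₁ hS B (Ext.mk₀ f) (add_zero 1) h
      obtain ⟨k, rfl⟩ := Ext.addEquiv₀.symm.surjective x₂
      refine ⟨ip.J, ip.injective, ip.f, k, ?_⟩
      apply Ext.addEquiv₀.symm.injective
      exact (Ext.mk₀_comp_mk₀ ip.f k).symm.trans hx₂
    · rintro ⟨I, hI, g, h, rfl⟩
      apply hilton_rees_ext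
      intro X x
      refine (happ (g ≫ h) X x).trans ?_
      rw [← Ext.mk₀_comp_mk₀, ← Ext.comp_assoc_of_third_deg_zero,
        Ext.eq_zero_of_injective (x.comp (Ext.mk₀ g) (add_zero 1)), Ext.zero_comp]
      rfl
end
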